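/- arXiv:0708.1253 — 3 statements merged into one kernel-verified Lean document; each statement's English description precedes it below -/
import Mathlib

section
/- Let S ∈ Mat_n(ℂ) satisfy Sᵀ = S and S² = 1. Let P ∈ Mat_n(ℂ) satisfy P² = P, and set P̄ = S·Pᵀ·S. Assume P·P̄ = 0 and P̄·P = 0. Then for every nonzero c ∈ ℂ, the matrix u = 1 + (c⁻¹ − 1)·P + (c − 1)·P̄ satisfies uᵀ·S·u = S; that is, u belongs to the orthogonal group defined by the bilinear form S. -/
/-- for `S` symmetric with `S² = 1`, a projector `P` with
`P̄ = S Pᵀ S` satisfying `P P̄ = P̄ P = 0`, and any `c ≠ 0`, the dressing factor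
`u = 1 + (c⁻¹ - 1) P + (c - 1) P̄` satisfies `uᵀ S u = S`, i.e. it belongs to the
orthogonal group of the bilinear form `S`. -/
theorem stmt_5 {n : ℕ} (S P : Matrix (Fin n) (Fin n) ℂ)
    (hS : S.transpose = S) (hS2 : S * S = 1) (hP : P * P = P)
    (hPPbar : P * (S * P.transpose * S) = 0)
    (hPbarP : (S * P.transpose * S) * P = 0)
    (c : ℂ) (hc : c ≠ 0) :
    (1 + (c⁻¹ - 1) • P + (c - 1) • (S * P.transpose * S)).transpose * S *
      (1 + (c⁻¹ - 1) • P + (c - 1) • (S * P.transpose * S)) = S := by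
  have h1 : P.transpose * S = S * (S * P.transpose * S) := by
    rw [← mul_assoc, ← mul_assoc, hS2, one_mul]
  have h2 : (S * P.transpose * S).transpose * S = S * P := by
    rw [Matrix.transpose_mul, Matrix.transpose_mul, Matrix.transpose_transpose, hS,
      mul_assoc, mul_assoc, hS2, mul_one]
  have h3 : (S * P.transpose * S) * (S * P.transpose * S) = S * P.transpose * S := by
    rw [mul_assoc (S * P.transpose), ← h1, mul_assoc S, ← mul_assoc P.transpose,
      ← Matrix.transpose_mul, hP, ← mul_assoc]
  generalize S * P.transpose * S = Q at *
  have hab : (c⁻¹ - 1) + (c - 1) + (c⁻¹ - 1) * (c - 1) = 0 := by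
    field_simp
    ring
  generalize c⁻¹ - 1 = a at *
  generalize c - 1 = b at *
  have h4 : (1 + a • P + b • Q).transpose * S = S * (1 + a • Q + b • P) := by
    simp only [Matrix.transpose_add, Matrix.transpose_smul, Matrix.transpose_one, add_mul,
      mul_add, Matrix.smul_mul, Matrix.mul_smul, h1, h2, one_mul, mul_one]
  have h5 : (1 + a • Q + b • P) * (1 + a • P + b • Q) = 1 := by
    have : (1 + a • Q + b • P) * (1 + a • P + b • Q)
        = 1 + (a + b + a * b) • P + (a + b + a * b) • Q := by
      simp only [add_mul, mul_add, Matrix.smul_mul, Matrix.mul_smul, one_mul, mul_one,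
        hP, h3, hPPbar, hPbarP, smul_zero]
      module
    rw [this, hab]
    simp
  rw [h4, mul_assoc, h5, mul_one]
end

section
/- Let J, q, q₀, P, P′ ∈ Mat_n(ℂ) and let λ⁺, λ⁻ ∈ ℂ with λ⁺ ≠ λ⁻. For λ ∈ ℂ, λ ≠ λ⁻, set c(λ) = (λ − λ⁺)/(λ − λ⁻) and u(λ) = 1 + (c(λ) − 1)·P. Suppose that for every λ ∈ ℂ with λ ≠ λ⁻ the identity i·(c(λ) − 1)·P′ + q·u(λ) − u(λ)·q₀ − λ·(c(λ) − 1)·[J, P] = 0 holds. Then q − q₀ = (λ⁻ − λ⁺)·[J, P]. -/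
/-- if the dressing-factor equation
`i (c(λ)-1) P′ + q u(λ) - u(λ) q₀ - λ (c(λ)-1) [J,P] = 0` holds for every `λ ≠ λ⁻`
(with `c(λ) = (λ-λ⁺)/(λ-λ⁻)` and `u(λ) = 1 + (c(λ)-1) P`), then
`q - q₀ = (λ⁻ - λ⁺) [J,P]`. -/
theorem stmt_6 {n : ℕ} (J q q0 P P' : Matrix (Fin n) (Fin n) ℂ)
    (lp lm : ℂ) (hne : lp ≠ lm)
    (h : ∀ lam : ℂ, lam ≠ lm →
      Complex.I • (((lam - lp) / (lam - lm) - 1) • P')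
        + q * (1 + ((lam - lp) / (lam - lm) - 1) • P)
        - (1 + ((lam - lp) / (lam - lm) - 1) • P) * q0
        - lam • (((lam - lp) / (lam - lm) - 1) • (J * P - P * J)) = 0) :
    q - q0 = (lm - lp) • (J * P - P * J) := by
  have h1 := h (lm + 1) (by simp)
  have h2 := h (lm - 1) (by simp)
  have e1 : (lm + 1 - lp) / (lm + 1 - lm) - 1 = lm - lp := by
    rw [show lm + 1 - lm = 1 by ring]; ring
  have e2 : (lm - 1 - lp) / (lm - 1 - lm) - 1 = -(lm - lp) := by
    rw [show lm - 1 - lm = -1 by ring]; ring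
  rw [e1] at h1
  rw [e2] at h2
  simp only [mul_add, add_mul, mul_one, one_mul, mul_smul_comm, smul_mul_assoc] at h1 h2
  generalize J * P - P * J = C at *
  generalize q * P = A at *
  generalize P * q0 = B at *
  ext i j
  have a1 := congrFun (congrFun h1 i) j
  have a2 := congrFun (congrFun h2 i) j
  simp only [Matrix.add_apply, Matrix.sub_apply, Matrix.smul_apply, smul_eq_mul,
    Matrix.zero_apply] at a1 a2 ⊢
  linear_combination (a1 + a2) / 2
end

section
/- Let J and I be real diagonal n×n matrices, λ⁺, λ⁻ ∈ ℂ, n₀ ∈ ℂⁿ a column vector and m₀ ∈ ℂⁿ a row vector. Define the column vector n(x,t) = exp(−i·λ⁺·(xJ + tI))·n₀ and the row vector m(x,t) = m₀·exp(i·λ⁻·(xJ + tI)), and assume the scalar β(x,t) = m(x,t)·n(x,t) is nonzero for every (x,t) ∈ ℝ². Define the rank-one projector P(x,t) = (n(x,t)·m(x,t))/β(x,t). Then P satisfies the matrix identity i[J, ∂ₜP] − i[I, ∂ₓP] + (λ⁺ − λ⁻)·[[J,P],[I,P]] = 0 at every point (x,t). Consequently the off-diagonal matrix Q(x,t) with off-diagonal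 entries equal to those of −(λ⁺ − λ⁻)·P(x,t) satisfies the N-wave equation i[J, ∂ₜQ] − i[I, ∂ₓQ] − [[J,Q],[I,Q]] = 0. -/
noncomputable section

/-- The complex diagonal matrix built from a real vector of diagonal entries. -/
def diagMat {n : ℕ} (J : Fin n → ℝ) : Matrix (Fin n) (Fin n) ℂ :=
  Matrix.diagonal (fun k => (J k : ℂ))

/-- Matrix commutator `[A, B] = A*B - B*A`. -/
def mcomm {n : ℕ} (A B : Matrix (Fin n) (Fin n) ℂ) : Matrix (Fin n) (Fin n) ℂ :=
  A * B - B * A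

/-- Entrywise partial derivative in the first (space) variable. -/
def dX {n : ℕ} (A : ℝ → ℝ → Matrix (Fin n) (Fin n) ℂ) (x t : ℝ) :
    Matrix (Fin n) (Fin n) ℂ :=
  Matrix.of fun i j => deriv (fun s => A s t i j) x

/-- Entrywise partial derivative in the second (time) variable. -/
def dT {n : ℕ} (A : ℝ → ℝ → Matrix (Fin n) (Fin n) ℂ) (x t : ℝ) :
    Matrix (Fin n) (Fin n) ℂ :=
  Matrix.of fun i j => deriv (fun s => A x s i j) t

theorem aux_deriv {n : ℕ} (a b : Fin n → ℝ) (lp lm : ℂ) (n0 m0 : Fin n → ℂ)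
    (β : ℝ → ℂ)
    (hβdef : ∀ x : ℝ, β x =
      ∑ k, (m0 k * Complex.exp (Complex.I * lm * ((a k * x + b k : ℝ) : ℂ))) *
        (Complex.exp (-Complex.I * lp * ((a k * x + b k : ℝ) : ℂ)) * n0 k))
    (hβ : ∀ x : ℝ, β x ≠ 0)
    (P : ℝ → Matrix (Fin n) (Fin n) ℂ)
    (hP : ∀ (x : ℝ) (k s : Fin n), P x k s =
      (Complex.exp (-Complex.I * lp * ((a k * x + b k : ℝ) : ℂ)) * n0 k) *
        (m0 s * Complex.exp (Complex.I * lm * ((a s * x + b s : ℝ) : ℂ))) / β x) (x : ℝ) :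
    (Matrix.of fun i j => deriv (fun s => P s i j) x) =
      (-(Complex.I * lp)) • (diagMat a * P x) + (Complex.I * lm) • (P x * diagMat a)
        + (Complex.I * (lp - lm)) • (P x * diagMat a * P x) := by
  have hlin : ∀ k, HasDerivAt (fun x : ℝ => ((a k * x + b k : ℝ) : ℂ)) (a k : ℂ) x := by
    intro k
    have h : HasDerivAt (fun x : ℝ => a k * x + b k) (a k) x := by
      simpa using ((hasDerivAt_id x).const_mul (a k)).add_const (b k)
    exact h.ofReal_comp
  have hn := fun k => (((hlin k).const_mul (-Complex.I * lp)).cexp).mul_const (n0 k)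
  have hm := fun k => (((hlin k).const_mul (Complex.I * lm)).cexp).const_mul (m0 k)
  have hs := HasDerivAt.fun_sum (u := Finset.univ) (fun k _ => (hm k).mul (hn k))
  have hβ' := hβ x
  ext k l
  have hb : HasDerivAt β (-(Complex.I * (lp - lm)) * (∑ r, (a r : ℂ) * P x r r) * β x) x := by
    have e : β = _ := funext hβdef
    rw [e]
    refine HasDerivAt.congr_deriv hs ?_
    rw [← e, Finset.mul_sum, Finset.sum_mul]
    refine Finset.sum_congr rfl fun r _ => ?_
    rw [hP]
    field_simp
    ring
  have hd := ((hn k).mul (hm l)).div hb hβ'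
  have e2 : (fun s => P s k l) = _ := funext fun s => hP s k l
  have key : (P x * diagMat a * P x) k l = (∑ r, (a r : ℂ) * P x r r) * P x k l := by
    rw [Matrix.mul_apply, Finset.sum_mul]
    refine Finset.sum_congr rfl fun r _ => ?_
    simp only [diagMat, Matrix.mul_diagonal]
    rw [hP, hP, hP, hP]
    field_simp
  simp only [Matrix.of_apply, Matrix.add_apply, Matrix.smul_apply, key, smul_eq_mul]
  simp only [diagMat, Matrix.mul_diagonal, Matrix.diagonal_mul]
  generalize (∑ r, (a r : ℂ) * P x r r) = S at *
  rw [e2]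
  refine hd.deriv.trans ?_
  rw [hP]
  simp only [Pi.mul_apply]
  field_simp
  ring

theorem aux_alg {n : ℕ} (A B P : Matrix (Fin n) (Fin n) ℂ) (hAB : B * A = A * B)
    (hPP : P * P = P) (lp lm : ℂ) :
    Complex.I • mcomm A ((-(Complex.I * lp)) • (B * P) + (Complex.I * lm) • (P * B)
        + (Complex.I * (lp - lm)) • (P * B * P))
      - Complex.I • mcomm B ((-(Complex.I * lp)) • (A * P) + (Complex.I * lm) • (P * A)
        + (Complex.I * (lp - lm)) • (P * A * P))
      + (lp - lm) • mcomm (mcomm A P) (mcomm B P) = 0 := by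
  have h2 : ∀ X, B * (A * X) = A * (B * X) := fun X => by
    rw [← mul_assoc, hAB, mul_assoc]
  have h3 : ∀ X, P * (P * X) = P * X := fun X => by
    rw [← mul_assoc, hPP]
  have hI : Complex.I * Complex.I = -1 := Complex.I_mul_I
  simp only [mcomm, mul_add, add_mul, mul_sub, sub_mul, smul_add, smul_sub, mul_smul_comm,
    smul_mul_assoc, smul_smul, mul_assoc, hAB, h2, hPP, h3, mul_neg, ← mul_assoc Complex.I Complex.I, hI]
  module

theorem aux_comm {n : ℕ} (a : Fin n → ℝ) (c : ℂ) (X Y : Matrix (Fin n) (Fin n) ℂ)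
    (h : ∀ k s, k ≠ s → X k s = c * Y k s) :
    mcomm (diagMat a) X = c • mcomm (diagMat a) Y := by
  ext k s
  simp only [mcomm, diagMat, Matrix.sub_apply, Matrix.smul_apply, Matrix.mul_diagonal,
    Matrix.diagonal_mul, smul_eq_mul]
  by_cases hk : k = s
  · subst hk; ring
  · rw [h k s hk]; ring

/-- the rank-one projector `P = |n⟩⟨m|/⟨m|n⟩` built from
`|n(x,t)⟩ = exp(-iλ⁺(xJ+tI))|n₀⟩` and `⟨m(x,t)| = ⟨m₀|exp(iλ⁻(xJ+tI))` satisfies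
`i[J,∂ₜP] - i[I,∂ₓP] + (λ⁺-λ⁻)[[J,P],[I,P]] = 0`, and consequently the off-diagonal
matrix `Q` with off-diagonal entries those of `-(λ⁺-λ⁻)P` satisfies the N-wave equation
`i[J,∂ₜQ] - i[I,∂ₓQ] - [[J,Q],[I,Q]] = 0`. -/
theorem stmt_7 {n : ℕ} (J I : Fin n → ℝ) (lp lm : ℂ) (n0 m0 : Fin n → ℂ)
    (β : ℝ → ℝ → ℂ)
    (hβdef : ∀ x t : ℝ, β x t =
      ∑ k, (m0 k * Complex.exp (Complex.I * lm * ((J k * x + I k * t : ℝ) : ℂ))) *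
        (Complex.exp (-Complex.I * lp * ((J k * x + I k * t : ℝ) : ℂ)) * n0 k))
    (hβ : ∀ x t : ℝ, β x t ≠ 0)
    (P : ℝ → ℝ → Matrix (Fin n) (Fin n) ℂ)
    (hP : ∀ (x t : ℝ) (k s : Fin n), P x t k s =
      (Complex.exp (-Complex.I * lp * ((J k * x + I k * t : ℝ) : ℂ)) * n0 k) *
        (m0 s * Complex.exp (Complex.I * lm * ((J s * x + I s * t : ℝ) : ℂ))) / β x t)
    (Q : ℝ → ℝ → Matrix (Fin n) (Fin n) ℂ)
    (hQ : ∀ (x t : ℝ) (k s : Fin n), Q x t k s =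
      if k = s then 0 else -(lp - lm) * P x t k s) :
    (∀ x t : ℝ,
      Complex.I • mcomm (diagMat J) (dT P x t)
        - Complex.I • mcomm (diagMat I) (dX P x t)
        + (lp - lm) • mcomm (mcomm (diagMat J) (P x t)) (mcomm (diagMat I) (P x t)) = 0) ∧
    (∀ x t : ℝ,
      Complex.I • mcomm (diagMat J) (dT Q x t)
        - Complex.I • mcomm (diagMat I) (dX Q x t)
        - mcomm (mcomm (diagMat J) (Q x t)) (mcomm (diagMat I) (Q x t)) = 0) := by
  have h1 : ∀ x t : ℝ,
      Complex.I • mcomm (diagMat J) (dT P x t)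
        - Complex.I • mcomm (diagMat I) (dX P x t)
        + (lp - lm) • mcomm (mcomm (diagMat J) (P x t)) (mcomm (diagMat I) (P x t)) = 0 := by
    intro x t
    have hX := aux_deriv J (fun k => I k * t) lp lm n0 m0 (fun s => β s t)
      (fun s => hβdef s t) (fun s => hβ s t) (fun s => P s t) (fun s => hP s t) x
    have hT := aux_deriv I (fun k => J k * x) lp lm n0 m0 (fun s => β x s)
      (fun s => by simp only [add_comm (I _ * s)]; exact hβdef x s) (fun s => hβ x s)
      (fun s => P x s)
      (fun s k l => by simp only [add_comm (I _ * s)]; exact hP x s k l) t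
    have hX' : dX P x t = _ := hX
    have hT' : dT P x t = _ := hT
    rw [hX', hT']
    refine aux_alg _ _ _ ?_ ?_ lp lm
    · simp only [diagMat, Matrix.diagonal_mul_diagonal, mul_comm]
    · have hb := hβ x t
      ext k l
      have hS : ∑ r, P x t r r = 1 := by
        simp only [hP]
        rw [← Finset.sum_div, div_eq_one_iff_eq hb, hβdef]
        exact Finset.sum_congr rfl fun r _ => mul_comm _ _
      rw [Matrix.mul_apply, ← one_mul (P x t k l), ← hS, Finset.sum_mul]
      refine Finset.sum_congr rfl fun r _ => ?_
      rw [hP, hP, hP, hP]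
      field_simp
  refine ⟨h1, fun x t => ?_⟩
  have hq : ∀ x t k s, k ≠ s → Q x t k s = -(lp - lm) * P x t k s := fun x t k s h => by
    rw [hQ, if_neg h]
  rw [aux_comm J (-(lp - lm)) (dT Q x t) (dT P x t),
    aux_comm I (-(lp - lm)) (dX Q x t) (dX P x t),
    aux_comm J (-(lp - lm)) _ _ (hq x t), aux_comm I (-(lp - lm)) _ _ (hq x t)]
  · have h := congrArg (fun M => (-(lp - lm)) • M) (h1 x t)
    simp only [smul_zero] at h
    rw [← h]
    generalize mcomm (diagMat J) (P x t) = U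
    generalize mcomm (diagMat I) (P x t) = V
    simp only [mcomm, smul_mul_smul_comm]
    module
  · intro k s h
    simp only [dX, Matrix.of_apply, hq _ _ k s h]
    exact deriv_const_mul_field _
  · intro k s h
    simp only [dT, Matrix.of_apply, hq _ _ k s h]
    exact deriv_const_mul_field _
end
end
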